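/- Let p be an odd prime and let m ≥ 1 be an odd integer. Then 2·(∑_{k=1}^{p−1} 1/k^m) + m·p·(∑_{k=1}^{p−1} 1/k^{m+1}) ≡ 0 (mod p³). Moreover, if p−1 does not divide m+3 then this quantity is ≡ 0 (mod p⁴), while if p−1 divides m+3 then it is ≡ −(1/12)·m(m+1)(m+2)·p³ (mod p⁴). -/

import Mathlib

open Finset

/-- A rational number is a `p`-integer if its `p`-adic valuation is nonnegative
(equivalently, its denominator is not divisible by `p`). -/
def IsPInteger (p : ℕ) (x : ℚ) : Prop := 0 ≤ padicValRat p x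

/-- `a ≡ b (mod p^m)` for `p`-integers: `(a - b) / p^m` is a `p`-integer. -/
def PModEq (p m : ℕ) (a b : ℚ) : Prop := IsPInteger p ((a - b) / (p : ℚ) ^ m)

/-- Truncation of the binomial series of `(1 - t)⁻ᵐ` after the cubic term. -/
lemma exists_pow_eq_binomial_truncation {A : Type*} [CommRing A] {t u : A} (h : u * (1 - t) = 1)
    (m : ℕ) : ∃ r : A, u ^ m = 1 + m * t + (m + 1).choose 2 * t ^ 2 + (m + 2).choose 3 * t ^ 3
      + t ^ 4 * r := by
  induction m with
  | zero => exact ⟨0, by simp⟩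
  | succ m ih =>
    obtain ⟨r, hr⟩ := ih
    refine ⟨u * r + u * (m + 3).choose 3, ?_⟩
    have h2 : ((m + 2).choose 2 : A) = (m + 1) + (m + 1).choose 2 := by
      rw [Nat.choose_succ_succ' (m + 1) 1]; simp
    have h3 : ((m + 3).choose 3 : A) = (m + 2).choose 2 + (m + 2).choose 3 := by
      rw [Nat.choose_succ_succ' (m + 2) 2]; simp
    rw [pow_succ, hr, show m + 1 + 1 = m + 2 from rfl, show m + 1 + 2 = m + 3 from rfl, h3, h2]
    push_cast
    linear_combination (1 + (m + 1) * t + ((m + 1) + (m + 1).choose 2 : A) * t ^ 2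
      + ((m + 1) + (m + 1).choose 2 + (m + 2).choose 3 : A) * t ^ 3) * h

lemma sum_Icc_reflect {A : Type*} [AddCommMonoid A] (p : ℕ) (f : ℕ → A) :
    ∑ k ∈ Icc 1 (p - 1), f (p - k) = ∑ k ∈ Icc 1 (p - 1), f k := by
  refine Finset.sum_nbij' (fun k => p - k) (fun k => p - k) ?_ ?_ ?_ ?_ ?_ <;>
    intro k hk <;> simp only [Finset.mem_Icc] at * <;> omega

/-- Expansion modulo `p ^ 4` of twice an odd power sum of inverses. -/
lemma pow_four_dvd_sum_inv_pow {A : Type*} [CommRing A] {p : ℕ} {v : ℕ → A}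
    (hv : ∀ k ∈ Icc 1 (p - 1), (k : A) * v k = 1) {m : ℕ} (hm : Odd m) :
    (p : A) ^ 4 ∣ 2 * ∑ k ∈ Icc 1 (p - 1), v k ^ m
      + m * p * ∑ k ∈ Icc 1 (p - 1), v k ^ (m + 1)
      + (m + 1).choose 2 * p ^ 2 * ∑ k ∈ Icc 1 (p - 1), v k ^ (m + 2)
      + (m + 2).choose 3 * p ^ 3 * ∑ k ∈ Icc 1 (p - 1), v k ^ (m + 3) := by
  rw [two_mul]
  nth_rewrite 2 [← sum_Icc_reflect]
  simp only [Finset.mul_sum, ← Finset.sum_add_distrib]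
  refine Finset.dvd_sum fun k hk => ?_
  have hk1 := hv k hk
  have hk2 := hv (p - k) (by simp only [Finset.mem_Icc] at *; omega)
  rw [Nat.cast_sub (by simp only [Finset.mem_Icc] at hk; omega)] at hk2
  have hu : (-(k * v (p - k))) * (1 - p * v k) = 1 := by
    linear_combination p * v (p - k) * hk1 + hk2
  obtain ⟨r, hr⟩ := exists_pow_eq_binomial_truncation hu m
  have hpow : (-(k * v (p - k))) ^ m * v k ^ m = -v (p - k) ^ m := by
    rw [← mul_pow, ← hm.neg_pow]
    congr 1
    linear_combination -v (p - k) * hk1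
  refine ⟨-(v k ^ (m + 4) * r), ?_⟩
  rw [hr] at hpow
  linear_combination hpow

/-- Twice the combination of power sums is determined modulo `p ^ 4` by the power sum of
exponent `-(m + 3)`. -/
lemma pow_four_dvd_two_mul_combination {A : Type*} [CommRing A] {p : ℕ} {v : ℕ → A}
    (hv : ∀ k ∈ Icc 1 (p - 1), (k : A) * v k = 1) {m : ℕ} (hm : Odd m) :
    (p : A) ^ 4 ∣ 2 * (2 * ∑ k ∈ Icc 1 (p - 1), v k ^ m
      + m * p * ∑ k ∈ Icc 1 (p - 1), v k ^ (m + 1))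
      - (m + 2).choose 3 * p ^ 3 * ∑ k ∈ Icc 1 (p - 1), v k ^ (m + 3) := by
  obtain ⟨a, ha⟩ := pow_four_dvd_sum_inv_pow hv hm
  obtain ⟨b, hb⟩ := pow_four_dvd_sum_inv_pow hv (m := m + 2) (hm.add_even even_two)
  have hchoose : ((m + 1).choose 2 * (m + 2) : A) = 3 * (m + 2).choose 3 := by
    have := Nat.add_one_mul_choose_eq (m + 1) 2
    have h' : (m + 1).choose 2 * (m + 2) = 3 * (m + 2).choose 3 := by linarith
    simpa using congrArg (Nat.cast : ℕ → A) h'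
  simp only [show m + 2 + 1 = m + 3 from rfl] at hb
  push_cast at hb
  refine ⟨2 * a - (m + 1).choose 2 * (p ^ 2 * b - (m + 3).choose 2 *
    ∑ k ∈ Icc 1 (p - 1), v k ^ (m + 2 + 2) - (m + 2 + 2).choose 3 * p *
    ∑ k ∈ Icc 1 (p - 1), v k ^ (m + 2 + 3)), ?_⟩
  linear_combination 2 * ha - (m + 1).choose 2 * p ^ 2 * hb
    + p ^ 3 * (∑ k ∈ Icc 1 (p - 1), v k ^ (m + 3)) * hchoose

lemma sum_Icc_inv_pow_zmod (p : ℕ) [Fact p.Prime] (n : ℕ) :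
    ∑ k ∈ Icc 1 (p - 1), ((k : ZMod p)⁻¹) ^ n = if (p - 1) ∣ n then -1 else 0 := by
  have h := FiniteField.sum_pow_units (ZMod p) n
  rw [ZMod.card] at h
  rw [← h, ← Fintype.sum_equiv (Equiv.inv (ZMod p)ˣ) (fun u => ((u⁻¹ : (ZMod p)ˣ) : ZMod p) ^ n) _
    (fun _ => rfl)]
  symm
  refine Finset.sum_bij (fun u _ => (u : ZMod p).val) ?_ ?_ ?_ ?_
  · intro u _
    have h1 := ZMod.val_lt (u : ZMod p)
    have h2 : (u : ZMod p).val ≠ 0 := by simp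
    simp only [Finset.mem_Icc]
    omega
  · intro u _ w _ h
    exact Units.ext (ZMod.val_injective p h)
  · intro k hk
    simp only [Finset.mem_Icc] at hk
    have hk0 : (k : ZMod p) ≠ 0 := by
      rw [Ne, ZMod.natCast_eq_zero_iff]
      exact Nat.not_dvd_of_pos_of_lt (by omega) (by omega)
    exact ⟨Units.mk0 _ hk0, Finset.mem_univ _, by simp [ZMod.val_natCast_of_lt (show k < p by omega)]⟩
  · intro u _
    rw [ZMod.natCast_zmod_val, Units.val_inv_eq_inv_val]

lemma isPInteger_iff_norm_le_one (p : ℕ) [Fact p.Prime] (x : ℚ) :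
    IsPInteger p x ↔ ‖(x : ℚ_[p])‖ ≤ 1 := by
  rcases eq_or_ne x 0 with rfl | hx
  · simp [IsPInteger]
  · have hp : 1 < (p : ℝ) := by exact_mod_cast (Fact.out : p.Prime).one_lt
    rw [Padic.norm_eq_zpow_neg_valuation (by exact_mod_cast hx), Padic.valuation_ratCast,
      zpow_le_one_iff_right₀ hp, IsPInteger, neg_nonpos]

/-- Congruences of rationals modulo `p ^ n` can be checked in `ℤ_[p]` after doubling. -/
lemma pModEq_of_pow_dvd {p : ℕ} [Fact p.Prime] (hodd : Odd p) {n : ℕ} {a b : ℚ} {z : ℤ_[p]}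
    (hz : ((2 * (a - b) : ℚ) : ℚ_[p]) = z) (hdvd : (p : ℤ_[p]) ^ n ∣ z) : PModEq p n a b := by
  obtain ⟨c, rfl⟩ := hdvd
  have hp0 : (p : ℚ_[p]) ≠ 0 := by exact_mod_cast (Fact.out : p.Prime).ne_zero
  have h2 : ‖(2 : ℚ_[p])‖ = 1 := by
    have := (Padic.norm_natCast_eq_one_iff (p := p) (n := 2)).2 (Nat.coprime_two_right.2 hodd)
    exact_mod_cast this
  rw [PModEq, isPInteger_iff_norm_le_one, ← one_mul ‖_‖, ← h2, ← norm_mul]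
  convert PadicInt.norm_le_one c using 1
  rw [← PadicInt.padic_norm_e_of_padicInt]
  congr 1
  push_cast at hz ⊢
  field_simp
  linear_combination hz


theorem power_sum_combination_mod_p3_p4 (p : ℕ) (hp : p.Prime) (hodd : Odd p)
    (m : ℕ) (hm : 1 ≤ m) (hmodd : Odd m) :
    PModEq p 3
      (2 * (∑ k ∈ Finset.Icc 1 (p - 1), (1 : ℚ) / (k ^ m))
        + m * p * (∑ k ∈ Finset.Icc 1 (p - 1), (1 : ℚ) / (k ^ (m + 1)))) 0 ∧
    (¬ (p - 1) ∣ (m + 3) →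
      PModEq p 4
        (2 * (∑ k ∈ Finset.Icc 1 (p - 1), (1 : ℚ) / (k ^ m))
          + m * p * (∑ k ∈ Finset.Icc 1 (p - 1), (1 : ℚ) / (k ^ (m + 1)))) 0) ∧
    ((p - 1) ∣ (m + 3) →
      PModEq p 4
        (2 * (∑ k ∈ Finset.Icc 1 (p - 1), (1 : ℚ) / (k ^ m))
          + m * p * (∑ k ∈ Finset.Icc 1 (p - 1), (1 : ℚ) / (k ^ (m + 1))))
        (-(1 / 12) * m * (m + 1) * (m + 2) * p ^ 3)) := by
  have : Fact p.Prime := ⟨hp⟩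
  have hunit : ∀ k ∈ Icc 1 (p - 1), IsUnit (k : ℤ_[p]) := by
    intro k hk
    simp only [Finset.mem_Icc] at hk
    rw [PadicInt.isUnit_iff, PadicInt.norm_natCast_eq_one_iff, hp.coprime_iff_not_dvd]
    exact Nat.not_dvd_of_pos_of_lt (by omega) (by omega)
  set v : ℕ → ℤ_[p] := fun k => Ring.inverse (k : ℤ_[p])
  have hv : ∀ k ∈ Icc 1 (p - 1), (k : ℤ_[p]) * v k = 1 := fun k hk =>
    Ring.mul_inverse_cancel _ (hunit k hk)
  have hcoe : ∀ n : ℕ, ((∑ k ∈ Icc 1 (p - 1), (1 : ℚ) / (k ^ n) : ℚ) : ℚ_[p])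
      = ((∑ k ∈ Icc 1 (p - 1), v k ^ n : ℤ_[p]) : ℚ_[p]) := by
    intro n
    rw [PadicInt.coe_sum, Rat.cast_sum]
    refine Finset.sum_congr rfl fun k hk => ?_
    have h : (k : ℚ_[p]) * v k = 1 := by exact_mod_cast congrArg ((↑) : ℤ_[p] → ℚ_[p]) (hv k hk)
    push_cast
    rw [eq_inv_of_mul_eq_one_right h, inv_pow, one_div]
  have hmod : PadicInt.toZMod (∑ k ∈ Icc 1 (p - 1), v k ^ (m + 3))
      = if (p - 1) ∣ (m + 3) then -1 else 0 := by
    rw [← sum_Icc_inv_pow_zmod, map_sum]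
    refine Finset.sum_congr rfl fun k hk => ?_
    have h : (k : ZMod p) * PadicInt.toZMod (v k) = 1 := by
      simpa using congrArg (PadicInt.toZMod (p := p)) (hv k hk)
    rw [map_pow, eq_inv_of_mul_eq_one_right h]
  have hker : ∀ z : ℤ_[p], PadicInt.toZMod z = 0 → (p : ℤ_[p]) ∣ z := by
    intro z hz
    rwa [← RingHom.mem_ker, PadicInt.ker_toZMod, PadicInt.maximalIdeal_eq_span_p,
      Ideal.mem_span_singleton] at hz
  have hchoose : (6 * (m + 2).choose 3 : ℚ_[p]) = m * (m + 1) * (m + 2) := by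
    have h1 := Nat.add_one_mul_choose_eq (m + 1) 2
    have h2 := Nat.add_one_mul_choose_eq m 1
    rw [Nat.choose_one_right] at h2
    have h' : 6 * (m + 2).choose 3 = m * (m + 1) * (m + 2) := by
      simp only [Nat.reduceAdd, add_assoc] at h1 h2
      nlinarith
    exact_mod_cast h'
  have hmain := pow_four_dvd_two_mul_combination hv hmodd
  have hcomb : ((2 * (2 * (∑ k ∈ Icc 1 (p - 1), (1 : ℚ) / (k ^ m))
      + m * p * (∑ k ∈ Icc 1 (p - 1), (1 : ℚ) / (k ^ (m + 1))) - 0) : ℚ) : ℚ_[p])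
      = ((2 * (2 * ∑ k ∈ Icc 1 (p - 1), v k ^ m
      + m * p * ∑ k ∈ Icc 1 (p - 1), v k ^ (m + 1)) : ℤ_[p]) : ℚ_[p]) := by
    rw [sub_zero, Rat.cast_mul, Rat.cast_add, Rat.cast_mul, Rat.cast_mul, hcoe, hcoe]
    push_cast
    rfl
  refine ⟨pModEq_of_pow_dvd hodd hcomb ?_, fun hdiv => pModEq_of_pow_dvd hodd hcomb ?_,
    fun hdiv => pModEq_of_pow_dvd hodd (z := 2 * (2 * ∑ k ∈ Icc 1 (p - 1), v k ^ m
      + m * p * ∑ k ∈ Icc 1 (p - 1), v k ^ (m + 1)) + (m + 2).choose 3 * p ^ 3) ?_ ?_⟩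
  · exact (dvd_sub_left ((Dvd.intro_left _ rfl).mul_right _)).1
      ((pow_dvd_pow _ (by norm_num)).trans hmain)
  · rw [if_neg hdiv] at hmod
    obtain ⟨c, hc⟩ := hker _ hmod
    refine (dvd_sub_left ?_).1 hmain
    rw [hc]
    exact ⟨(m + 2).choose 3 * c, by ring⟩
  · rw [PadicInt.coe_add, ← hcomb]
    push_cast
    linear_combination (-(1 : ℚ_[p]) / 6 * p ^ 3) * hchoose
  · rw [if_pos hdiv] at hmod
    obtain ⟨c, hc⟩ := hker (∑ k ∈ Icc 1 (p - 1), v k ^ (m + 3) + 1) (by simp [hmod])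
    obtain ⟨d, hd⟩ := hmain
    refine ⟨d + (m + 2).choose 3 * c, ?_⟩
    linear_combination hd + (m + 2).choose 3 * p ^ 3 * hc
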